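/- Let κ = (κ₁,…,κₙ) ∈ ℕⁿ, let each C_i ⊆ ℂ (1 ≤ i ≤ n) be either an open disc or the open exterior of a closed disc, and let f, g ∈ ℂ_κ[z₁,…,zₙ]. Suppose that (i) f is C₁×⋯×Cₙ-stable and deg_{z_j}(f) = κ_j whenever C_j is the exterior of a disc, and (ii) g is (ℂ∖C₁)×⋯×(ℂ∖Cₙ)-stable and deg_{z_j}(g) = κ_j whenever C_j is a disc. Then the apolarity form {f,g}_κ = Σ_{α≤κ} (−1)^{|α|} (∂^α f)(0) · (∂^{κ−α} g)(0) is nonzero. -/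

import Mathlib

open MvPolynomial

/-- The iterated partial derivative `∂^α = ∂^{|α|}/∂z₁^{α₁}⋯∂zₙ^{αₙ}`,
as a linear endomorphism of the polynomial ring. -/
noncomputable def pdPow {n : ℕ} (α : Fin n →₀ ℕ) :
    Module.End ℂ (MvPolynomial (Fin n) ℂ) :=
  (List.ofFn fun i : Fin n => ((pderiv i : Derivation ℂ (MvPolynomial (Fin n) ℂ)
      (MvPolynomial (Fin n) ℂ)).toLinearMap) ^ (α i)).prod

/-- The apolarity form `{f,g}_κ = ∑_{α ≤ κ} (−1)^{|α|} (∂^α f)(0) (∂^{κ−α} g)(0)`. -/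
noncomputable def apolarForm {n : ℕ} (κ : Fin n →₀ ℕ)
    (f g : MvPolynomial (Fin n) ℂ) : ℂ :=
  ∑ α ∈ Finset.Iic κ,
    (-1 : ℂ) ^ (∑ i, α i) * eval 0 (pdPow α f) * eval 0 (pdPow (κ - α) g)

section
open MvPolynomial

/-- Hermitian form -/
def IsHerm (Q : ℂ × ℂ → ℝ) : Prop :=
  ∃ (a c : ℝ) (b : ℂ), ∀ p : ℂ × ℂ, Q p = a * Complex.normSq p.1 +
    2 * (b * p.1 * (starRingEnd ℂ) p.2).re + c * Complex.normSq p.2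

lemma IsHerm.neg {Q} (h : IsHerm Q) : IsHerm (fun p => - Q p) := by
  obtain ⟨a, c, b, h⟩ := h
  refine ⟨-a, -c, -b, fun p => ?_⟩
  simp only [h]; simp; ring

lemma IsHerm.add_norm {Q} (h : IsHerm Q) (e : ℝ) :
    IsHerm (fun p => Q p + e * (Complex.normSq p.1 + Complex.normSq p.2)) := by
  obtain ⟨a, c, b, h⟩ := h
  refine ⟨a + e, c + e, b, fun p => ?_⟩
  simp only [h]; ring

lemma IsHerm.continuous {Q} (h : IsHerm Q) : Continuous Q := by
  obtain ⟨a, c, b, h⟩ := h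
  rw [show Q = _ from funext h]
  have := Complex.continuous_normSq
  have := Complex.continuous_re
  have := Complex.continuous_conj
  fun_prop

lemma IsHerm.smul {Q} (h : IsHerm Q) (l : ℂ) (p : ℂ × ℂ) :
    Q (l * p.1, l * p.2) = Complex.normSq l * Q p := by
  obtain ⟨a, c, b, h⟩ := h
  rw [h, h]; simp [Complex.normSq_apply]; ring

lemma IsHerm.convex {Q} (h : IsHerm Q) (p z : ℂ × ℂ) (hp : Q p < 0) :
    Convex ℝ {m : ℂ | 0 ≤ Q (z.1 - m * p.1, z.2 - m * p.2)} := by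
  obtain ⟨a, c, b, h⟩ := h
  intro x hx y hy s t hs ht hst
  simp only [Set.mem_ofPred_eq] at *
  have key : Q (z.1 - (s • x + t • y) * p.1, z.2 - (s • x + t • y) * p.2) =
      s * Q (z.1 - x * p.1, z.2 - x * p.2) + t * Q (z.1 - y * p.1, z.2 - y * p.2)
      + s * t * Complex.normSq (x - y) * (- Q p) := by
    have : t = 1 - s := by linarith
    subst this
    simp only [h]
    simp [Complex.normSq_apply]
    ring
  rw [key]
  have := Complex.normSq_nonneg (x - y)
  have h3 : 0 ≤ - Q p := by linarith
  positivity

lemma poly_logderiv (φ : Polynomial ℂ) (S : Set ℂ) (hS : Convex ℝ S) (h0 : (0:ℂ) ∉ S)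
    (hd : 1 ≤ φ.natDegree) (hφ : φ.eval 0 ≠ 0) (hr : ∀ t, φ.eval t = 0 → -t⁻¹ ∈ S) :
    φ.derivative.eval 0 ≠ 0 := by
  intro hc
  have hsp := IsAlgClosed.splits φ
  have h1 := hsp.eval_derivative_div_eval_of_ne_zero hφ
  rw [hc, zero_div] at h1
  have hne : φ ≠ 0 := by rintro rfl; simp at hφ
  have hcard : φ.roots.card = φ.natDegree := hsp.natDegree_eq_card_roots.symm
  set M := φ.roots.map (fun z => 1 / (0 - z)) with hM
  have hMS : ∀ x ∈ M, x ∈ S := by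
    intro x hx
    obtain ⟨t, ht, rfl⟩ := Multiset.mem_map.1 hx
    have := hr t ((Polynomial.mem_roots hne).1 ht)
    convert this using 1
    rw [zero_sub, one_div, inv_neg]
  have hMc : 1 ≤ M.card := by rw [hM, Multiset.card_map, hcard]; exact hd
  -- average
  have gen : ∀ M : Multiset ℂ, (∀ x ∈ M, x ∈ S) → 1 ≤ M.card →
      ((M.card : ℝ)⁻¹) • M.sum ∈ S := by
    intro M
    induction M using Multiset.induction with
    | empty => intro _ h; simp at h
    | cons a M ih =>
      intro hm _
      by_cases hc : M.card = 0
      · rw [Multiset.card_eq_zero] at hc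
        subst hc
        simpa using hm a (by simp)
      · have hk : 0 < M.card := Nat.pos_of_ne_zero hc
        have h2 := ih (fun x hx => hm x (by simp [hx])) hk
        have h3 := hm a (by simp)
        have hk' : (0:ℝ) < M.card := by exact_mod_cast hk
        have := hS h3 h2 (a := ((M.card + 1 : ℝ))⁻¹) (b := M.card * ((M.card + 1 : ℝ))⁻¹)
          (by positivity) (by positivity) (by field_simp; ring)
        convert this using 1
        rw [smul_smul]
        simp only [Multiset.card_cons, Multiset.sum_cons, smul_add]
        push_cast
        congr 2
        field_simp
  have := gen M hMS hMc
  rw [← h1, smul_zero] at this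
  exact h0 this

open Finset in
lemma laguerre {Q} (hQ : IsHerm Q) (k : ℕ) (c : ℕ → ℂ)
    (h : ∀ p : ℂ × ℂ, Q p < 0 → ∑ i ∈ range (k + 2), c i * p.1 ^ i * p.2 ^ (k + 1 - i) ≠ 0)
    (p z : ℂ × ℂ) (hp : Q p < 0) (hz : Q z < 0) :
    ∑ i ∈ range (k + 1), ((i + 1) * c (i + 1) * z.1 + (k + 1 - i) * c i * z.2) *
      p.1 ^ i * p.2 ^ (k - i) ≠ 0 := by
  classical
  set φ : Polynomial ℂ := ∑ i ∈ range (k + 2), Polynomial.C (c i) *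
    (Polynomial.C z.1 * Polynomial.X + Polynomial.C p.1) ^ i *
    (Polynomial.C z.2 * Polynomial.X + Polynomial.C p.2) ^ (k + 1 - i) with hφ
  have hev : ∀ t, φ.eval t = ∑ i ∈ range (k + 2), c i * (z.1 * t + p.1) ^ i *
      (z.2 * t + p.2) ^ (k + 1 - i) := by
    intro t
    simp [hφ, Polynomial.eval_finsetSum]
  have hlin : ∀ a b : ℂ, (Polynomial.C a * Polynomial.X + Polynomial.C b).natDegree ≤ 1 :=
    fun a b => Polynomial.natDegree_linear_le
  have hco : φ.coeff (k + 1) = ∑ i ∈ range (k + 2), c i * z.1 ^ i * z.2 ^ (k + 1 - i) := by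
    rw [hφ, Polynomial.finsetSum_coeff]
    refine sum_congr rfl fun i hi => ?_
    have hi' : i ≤ k + 1 := by have := mem_range.1 hi; omega
    rw [mul_assoc, Polynomial.coeff_C_mul, mul_assoc]
    congr 1
    have e : k + 1 = i * 1 + (k + 1 - i) * 1 := by omega
    conv_lhs => rw [show Polynomial.coeff _ (k+1) = Polynomial.coeff
      ((Polynomial.C z.1 * Polynomial.X + Polynomial.C p.1) ^ i *
    (Polynomial.C z.2 * Polynomial.X + Polynomial.C p.2) ^ (k + 1 - i)) (i * 1 + (k + 1 - i) * 1) from by rw [← e]]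
    rw [Polynomial.coeff_mul_add_eq_of_natDegree_le
      (Polynomial.natDegree_pow_le_of_le i (hlin _ _))
      (Polynomial.natDegree_pow_le_of_le _ (hlin _ _)),
      Polynomial.coeff_pow_of_natDegree_le (hlin _ _), Polynomial.coeff_pow_of_natDegree_le (hlin _ _)]
    simp
  have hd : 1 ≤ φ.natDegree := by
    have : φ.coeff (k + 1) ≠ 0 := by rw [hco]; exact h z hz
    have := Polynomial.le_natDegree_of_ne_zero this
    omega
  have h0 : φ.eval 0 ≠ 0 := by rw [hev]; simpa using h p hp
  have main := poly_logderiv φ {m : ℂ | 0 ≤ Q (z.1 - m * p.1, z.2 - m * p.2)}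
    (hQ.convex p z hp) (by simpa using hz) hd h0 (by
      intro t ht
      have ht0 : t ≠ 0 := by rintro rfl; exact h0 ht
      have h1 : 0 ≤ Q (z.1 * t + p.1, z.2 * t + p.2) := by
        by_contra hneg
        rw [not_le] at hneg
        apply h _ hneg
        rw [hev] at ht; exact ht
      have h2 := hQ.smul t⁻¹ (z.1 * t + p.1, z.2 * t + p.2)
      simp only [Set.mem_ofPred_eq]
      have e1 : z.1 - -t⁻¹ * p.1 = t⁻¹ * (z.1 * t + p.1) := by field_simp; ring
      have e2 : z.2 - -t⁻¹ * p.2 = t⁻¹ * (z.2 * t + p.2) := by field_simp; ring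
      rw [e1, e2, h2]
      exact mul_nonneg (Complex.normSq_nonneg _) h1)
  have hder : φ.derivative.eval 0 = ∑ i ∈ range (k + 2),
      (c i * (i * z.1 * p.1 ^ (i - 1)) * p.2 ^ (k + 1 - i) +
        c i * p.1 ^ i * ((k + 1 - i : ℕ) * z.2 * p.2 ^ (k + 1 - i - 1))) := by
    rw [hφ, Polynomial.derivative_sum, Polynomial.eval_finsetSum]
    refine sum_congr rfl fun i hi => ?_
    simp [Polynomial.derivative_mul, Polynomial.derivative_pow]
    ring
  rw [hder] at main
  convert main using 1
  rw [sum_add_distrib]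
  conv_rhs => rw [sum_range_succ', sum_range_succ _ (k + 1)]
  simp only [Nat.sub_self, Nat.cast_zero, zero_mul, mul_zero, add_zero]
  rw [← sum_add_distrib]
  refine sum_congr rfl fun i hi => ?_
  have hi' : i ≤ k := by have := mem_range.1 hi; omega
  have e1 : k + 1 - (i + 1) = k - i := by omega
  have e2 : k + 1 - i - 1 = k - i := by omega
  rw [e1, e2, Nat.cast_sub (by omega)]
  push_cast
  ring

/-- contraction of a bilinear form -/
lemma contraction {Q : ℂ × ℂ → ℝ} (U : Set (ℂ × ℂ))
    (hU : ∀ q : ℂ × ℂ, q ≠ 0 → 0 ≤ Q q → q ∈ U) (hω : ∃ w ∈ U, Q w < 0)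
    (a b c d : ℂ)
    (h : ∀ p q : ℂ × ℂ, Q p < 0 → q ∈ U →
      a * p.1 * q.1 + b * p.1 * q.2 + c * p.2 * q.1 + d * p.2 * q.2 ≠ 0) : b - c ≠ 0 := by
  intro hbc
  have hcb : c = b := (sub_eq_zero.1 hbc).symm
  subst hcb
  obtain ⟨w, hwU, hw⟩ := hω
  -- L q = (-(c q.1 + d q.2), a q.1 + b q.2)
  have step : ∀ q ∈ U, (-(c * q.1 + d * q.2), a * q.1 + c * q.2) ∈ U := by
    intro q hq
    apply hU
    · intro h0
      have h1 := congrArg Prod.fst h0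
      have h2 := congrArg Prod.snd h0
      simp only [Prod.fst_zero, Prod.snd_zero, neg_eq_zero] at h1 h2
      apply h w q hw hq
      linear_combination w.1 * h2 + w.2 * h1
    · by_contra hneg
      rw [not_le] at hneg
      apply h _ q hneg hq
      ring
  have s1 := step w hwU
  apply h w _ hw s1
  simp only
  ring

end

section
open MvPolynomial
open Finset in
lemma key1 {Q Q' : ℂ × ℂ → ℝ} (hQ : IsHerm Q) (hQ' : IsHerm Q')
    (hU : ∀ q : ℂ × ℂ, q ≠ 0 → 0 ≤ Q q → Q' q < 0) (hw : ∃ w, Q' w < 0 ∧ Q w < 0) (k : ℕ) :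
    ∀ (a : ℕ → ℕ → ℂ), (∀ p q : ℂ × ℂ, Q p < 0 → Q' q < 0 →
      ∑ i ∈ range (k + 1), ∑ j ∈ range (k + 1),
        a i j * (p.1 ^ i * p.2 ^ (k - i)) * (q.1 ^ j * q.2 ^ (k - j)) ≠ 0) →
      ∑ i ∈ range (k + 1), ((-1) ^ i * (i.factorial : ℂ) * ((k - i).factorial : ℂ)) * a i (k - i) ≠ 0 := by
  induction k with
  | zero =>
    intro a h
    obtain ⟨w, h1, h2⟩ := hw
    simpa using h w w h2 h1
  | succ k ih =>
    intro a h
    have h1 : ∀ p q z : ℂ × ℂ, Q p < 0 → Q' q < 0 → Q z < 0 →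
        ∑ j ∈ range (k + 2), (∑ i ∈ range (k + 1), ((i + 1) * a (i + 1) j * z.1 + (k + 1 - i) * a i j * z.2) *
      p.1 ^ i * p.2 ^ (k - i)) * q.1 ^ j * q.2 ^ (k + 1 - j) ≠ 0 := by
      intro p q z hp hq hz
      have := laguerre hQ k (fun i => ∑ j ∈ range (k + 2), a i j * (q.1 ^ j * q.2 ^ (k + 1 - j)))
        (by
          intro p hp
          have := h p q hp hq
          convert this using 1
          refine sum_congr rfl fun i _ => ?_
          simp only [sum_mul]
          refine sum_congr rfl fun j _ => ?_
          ring) p z hp hz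
      convert this using 1
      simp only [sum_mul, mul_sum, ← sum_add_distrib]
      rw [sum_comm]
      refine sum_congr rfl fun i _ => ?_
      refine sum_congr rfl fun j _ => ?_
      ring
    have h2 : ∀ p q z w : ℂ × ℂ, Q p < 0 → Q' q < 0 → Q z < 0 → Q' w < 0 →
       ∑ j ∈ range (k + 1), ((j + 1) * (∑ i ∈ range (k + 1), ((i + 1) * a (i + 1) (j + 1) * z.1 + (k + 1 - i) * a i (j + 1) * z.2) *
      p.1 ^ i * p.2 ^ (k - i)) * w.1 + (k + 1 - j) * (∑ i ∈ range (k + 1), ((i + 1) * a (i + 1) j * z.1 + (k + 1 - i) * a i j * z.2) *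
      p.1 ^ i * p.2 ^ (k - i)) * w.2) * q.1 ^ j * q.2 ^ (k - j) ≠ 0 := by
      intro p q z w hp hq hz hw'
      exact laguerre hQ' k (fun j => (∑ i ∈ range (k + 1), ((i + 1) * a (i + 1) j * z.1 + (k + 1 - i) * a i j * z.2) *
      p.1 ^ i * p.2 ^ (k - i))) (fun q hq => h1 p q z hp hq hz) q w hq hw'
    have h3 := ih (fun i j => (i + 1) * (k + 1 - j) * a (i + 1) j - (k + 1 - i) * (j + 1) * a i (j + 1)) (by
      intro p q hp hq
      have := contraction {q | Q' q < 0} hU (by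
          obtain ⟨w, h1, h2⟩ := hw
          exact ⟨w, h1, h2⟩)
        (∑ i ∈ range (k + 1), ∑ j ∈ range (k + 1), (i + 1) * (j + 1) * a (i + 1) (j + 1) * (p.1 ^ i * p.2 ^ (k - i)) * (q.1 ^ j * q.2 ^ (k - j)))
        (∑ i ∈ range (k + 1), ∑ j ∈ range (k + 1), (i + 1) * (k + 1 - j) * a (i + 1) j * (p.1 ^ i * p.2 ^ (k - i)) * (q.1 ^ j * q.2 ^ (k - j)))
        (∑ i ∈ range (k + 1), ∑ j ∈ range (k + 1), (k + 1 - i) * (j + 1) * a i (j + 1) * (p.1 ^ i * p.2 ^ (k - i)) * (q.1 ^ j * q.2 ^ (k - j)))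
        (∑ i ∈ range (k + 1), ∑ j ∈ range (k + 1), (k + 1 - i) * (k + 1 - j) * a i j * (p.1 ^ i * p.2 ^ (k - i)) * (q.1 ^ j * q.2 ^ (k - j)))
        (by
          intro z w hz hw'
          have := h2 p q z w hp hq hz hw'
          convert this using 1
          simp only [sum_mul, mul_sum, ← sum_add_distrib]
          rw [sum_comm]
          refine sum_congr rfl fun i _ => ?_
          refine sum_congr rfl fun j _ => ?_
          ring)
      convert this using 1
      simp only [← sum_sub_distrib]
      refine sum_congr rfl fun i _ => ?_
      refine sum_congr rfl fun j _ => ?_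
      ring)
    intro hc
    apply h3
    have e : ∀ i ∈ range (k + 1), ((-1 : ℂ) ^ i * (i.factorial : ℂ) * ((k - i).factorial : ℂ)) *
      ((i + 1) * (k + 1 - (k - i : ℕ)) * a (i + 1) (k - i) - (k + 1 - i) * ((k - i : ℕ) + 1) * a i (k - i + 1)) =
      - (((-1) ^ (i + 1) * ((i + 1).factorial : ℂ) * ((k + 1 - (i + 1)).factorial : ℂ)) * a (i + 1) (k + 1 - (i + 1)) * (i + 1 : ℕ))
      - (((-1) ^ i * ((i).factorial : ℂ) * ((k + 1 - i).factorial : ℂ)) * a i (k + 1 - i) * (k + 1 - i)) := by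
      intro i hi
      have hi' : i ≤ k := by have := mem_range.1 hi; omega
      have e1 : k + 1 - (i + 1) = k - i := by omega
      have e2 : k + 1 - i = (k - i) + 1 := by omega
      rw [e1, e2, Nat.factorial_succ, Nat.factorial_succ]
      push_cast [Nat.cast_sub hi']
      ring
    rw [sum_congr rfl e, sum_sub_distrib, sum_neg_distrib]
    have s1 := sum_range_succ' (fun i => ((-1 : ℂ) ^ i * (i.factorial : ℂ) * ((k + 1 - i).factorial : ℂ)) * a i (k + 1 - i) * (i : ℕ)) (k + 1)
    have s2 := sum_range_succ (fun i => ((-1 : ℂ) ^ i * (i.factorial : ℂ) * ((k + 1 - i).factorial : ℂ)) * a i (k + 1 - i) * (k + 1 - i)) (k + 1)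
    simp only [Nat.cast_zero, mul_zero, add_zero] at s1
    have z : (k + 1 - (k + 1 : ℕ) : ℂ) = 0 := by push_cast; ring
    rw [z, mul_zero, add_zero] at s2
    rw [← s1, ← s2, ← neg_add', ← sum_add_distrib, neg_eq_zero]
    have : ∑ i ∈ range (k + 1 + 1), ((-1 : ℂ) ^ i * (i.factorial : ℂ) * ((k + 1 - i).factorial : ℂ)) * a i (k + 1 - i) * (k + 1) = 0 := by
      rw [← sum_mul, hc, zero_mul]
    rw [← this]
    refine sum_congr rfl fun i _ => ?_
    ring

/-- multihomogeneous form with given coefficients -/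
noncomputable def hform {n : ℕ} (κ : Fin n → ℕ) (c : ((i : Fin n) → Fin (κ i + 1)) → ℂ)
    (p : Fin n → ℂ × ℂ) : ℂ :=
  ∑ α, c α * ∏ i, ((p i).1 ^ (α i : ℕ) * (p i).2 ^ (κ i - α i : ℕ))

lemma keyn (n : ℕ) : ∀ (κ : Fin n → ℕ) (Q Q' : Fin n → ℂ × ℂ → ℝ) (_ : ∀ i, IsHerm (Q i)) (_ : ∀ i, IsHerm (Q' i))
    (_ : ∀ i, ∀ q : ℂ × ℂ, q ≠ 0 → 0 ≤ Q i q → Q' i q < 0) (_ : ∀ i, ∃ w, Q' i w < 0 ∧ Q i w < 0)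
    (a : ((i : Fin n) → Fin (κ i + 1)) → ((i : Fin n) → Fin (κ i + 1)) → ℂ)
    (_ : ∀ p q : Fin n → ℂ × ℂ, (∀ i, Q i (p i) < 0) → (∀ i, Q' i (q i) < 0) →
      ∑ α, ∑ β, a α β * (∏ i, ((p i).1 ^ (α i : ℕ) * (p i).2 ^ (κ i - α i : ℕ))) *
        (∏ i, ((q i).1 ^ (β i : ℕ) * (q i).2 ^ (κ i - β i : ℕ))) ≠ 0),
    ∑ α, (∏ i, ((-1) ^ (α i : ℕ) * ((α i : ℕ).factorial : ℂ) * ((κ i - α i : ℕ).factorial : ℂ)))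
      * a α (fun i => (α i).rev) ≠ 0 := by
  induction n with
  | zero =>
    intro κ Q Q' _ _ _ _ a h
    have := h Fin.elim0 Fin.elim0 (fun i => i.elim0) (fun i => i.elim0)
    simp only [Finset.univ_unique, Finset.sum_singleton, Finset.univ_eq_empty, Finset.prod_empty, mul_one, one_mul] at this ⊢
    convert this
  | succ n ih =>
    intro κ Q Q' hQ hQ' hU hw a h
    have hce : ∀ (i : Fin (κ 0 + 1)) (α : (i : Fin n) → Fin (κ i.succ + 1)),
        (Fin.consEquiv (fun i => Fin (κ i + 1))) (i, α) = Fin.cons i α := fun _ _ => rfl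
    have key : ∀ p q : Fin n → ℂ × ℂ, (∀ i, Q i.succ (p i) < 0) → (∀ i, Q' i.succ (q i) < 0) →
      ∑ i : Fin (κ 0 + 1), ((-1) ^ (i : ℕ) * ((i : ℕ).factorial : ℂ) * ((κ 0 - i : ℕ).factorial : ℂ)) *
       (∑ α : (i : Fin n) → Fin (κ i.succ + 1), ∑ β : (i : Fin n) → Fin (κ i.succ + 1),
          a (Fin.cons i α) (Fin.cons i.rev β) * (∏ i, ((p i).1 ^ (α i : ℕ) * (p i).2 ^ (κ i.succ - α i : ℕ))) *
        (∏ i, ((q i).1 ^ (β i : ℕ) * (q i).2 ^ (κ i.succ - β i : ℕ)))) ≠ 0 := by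
      intro p q hp hq
      have := key1 (hQ 0) (hQ' 0) (hU 0) (hw 0) (κ 0) (fun i j =>
        ∑ α : (i : Fin n) → Fin (κ i.succ + 1), ∑ β : (i : Fin n) → Fin (κ i.succ + 1),
          a (Fin.cons (Fin.ofNat _ i) α) (Fin.cons (Fin.ofNat _ j) β) * (∏ i, ((p i).1 ^ (α i : ℕ) * (p i).2 ^ (κ i.succ - α i : ℕ))) *
        (∏ i, ((q i).1 ^ (β i : ℕ) * (q i).2 ^ (κ i.succ - β i : ℕ)))) (by
          intro p0 q0 hp0 hq0
          have := h (Fin.cons p0 p) (Fin.cons q0 q) (by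
            intro i; refine Fin.cases ?_ (fun i => ?_) i
            · simpa using hp0
            · simpa using hp i) (by
            intro i; refine Fin.cases ?_ (fun i => ?_) i
            · simpa using hq0
            · simpa using hq i)
          convert this using 1
          rw [← (Fin.consEquiv (fun i => Fin (κ i + 1))).sum_comp, Fintype.sum_prod_type, Finset.sum_range]
          refine Finset.sum_congr rfl fun i _ => ?_
          rw [Finset.sum_range]
          simp only [Finset.sum_mul]
          rw [Finset.sum_comm]
          refine Finset.sum_congr rfl fun α _ => ?_
          rw [← (Fin.consEquiv (fun i => Fin (κ i + 1))).sum_comp, Fintype.sum_prod_type]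
          refine Finset.sum_congr rfl fun j _ => ?_
          refine Finset.sum_congr rfl fun β _ => ?_
          simp only [hce, Fin.prod_univ_succ, Fin.cons_zero, Fin.cons_succ, Fin.ofNat_eq_cast, Fin.cast_val_eq_self]
          ring)
      convert this using 1
      rw [Finset.sum_range]
      refine Finset.sum_congr rfl fun i _ => ?_
      have e : Fin.ofNat (κ 0 + 1) (κ 0 - i) = i.rev := by
        ext; simp [Fin.val_rev]
      simp only [e]
      simp only [Fin.ofNat_eq_cast, Fin.cast_val_eq_self]
    have := ih (fun i => κ i.succ) (fun i => Q i.succ) (fun i => Q' i.succ) (fun i => hQ _) (fun i => hQ' _)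
      (fun i => hU _) (fun i => hw _) (fun α β => ∑ i : Fin (κ 0 + 1), ((-1) ^ (i : ℕ) * ((i : ℕ).factorial : ℂ) * ((κ 0 - i : ℕ).factorial : ℂ)) *
        a (Fin.cons i α) (Fin.cons i.rev β)) (by
        intro p q hp hq
        have := key p q hp hq
        convert this using 1
        simp only [Finset.sum_mul, Finset.mul_sum]
        conv_rhs => rw [Finset.sum_comm]
        refine Finset.sum_congr rfl fun α _ => ?_
        conv_rhs => rw [Finset.sum_comm]
        refine Finset.sum_congr rfl fun β _ => ?_
        refine Finset.sum_congr rfl fun i _ => ?_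
        ring)
    convert this using 1
    rw [← (Fin.consEquiv (fun i => Fin (κ i + 1))).sum_comp, Fintype.sum_prod_type, Finset.sum_comm]
    refine Finset.sum_congr rfl fun α _ => ?_
    rw [Finset.mul_sum]
    refine Finset.sum_congr rfl fun i _ => ?_
    have e : (fun j => ((Fin.cons i α : (j : Fin (n+1)) → Fin (κ j + 1)) j).rev) = Fin.cons i.rev (fun j => (α j).rev) := by
      funext j; refine Fin.cases ?_ (fun j => ?_) j <;> simp
    simp only [hce, Fin.prod_univ_succ, Fin.cons_zero, Fin.cons_succ, e]
    ring

end

section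
open MvPolynomial Filter Topology

lemma poly_growth (P : Polynomial ℂ) (D : ℕ) (hD : P.natDegree ≤ D) (δ : ℝ) (hδ : 0 < δ)
    (h : ∀ t : ℂ, ‖t‖ < δ → P.eval t ≠ 0) :
    ‖P.eval 1‖ ≤ ‖P.eval 0‖ * (1 + 1 / δ) ^ D := by
  have hsp := IsAlgClosed.splits P
  have hne : P ≠ 0 := by rintro rfl; simpa using h 0 (by simpa using hδ)
  have hcard : P.roots.card = P.natDegree := hsp.natDegree_eq_card_roots.symm
  have h1 : (1:ℝ) ≤ 1 + 1 / δ := by have : 0 < 1 / δ := by positivity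
                                    linarith
  have hr : ∀ t ∈ P.roots, δ ≤ ‖t‖ := by
    intro t ht
    by_contra hc
    exact h t (not_le.1 hc) ((Polynomial.mem_roots hne).1 ht)
  have gen : ∀ M : Multiset ℂ, (∀ t ∈ M, δ ≤ ‖t‖) →
      ‖(M.map (fun t => 1 - t)).prod‖ ≤ ‖(M.map (fun t => 0 - t)).prod‖ * (1 + 1 / δ) ^ M.card := by
    intro M
    induction M using Multiset.induction with
    | empty => intro _; simp
    | cons t M ih =>
      intro hM
      have ih' := ih (fun x hx => hM x (by simp [hx]))
      have ht := hM t (by simp)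
      simp only [Multiset.map_cons, Multiset.prod_cons, norm_mul, Multiset.card_cons, pow_succ]
      have : ‖1 - t‖ ≤ ‖0 - t‖ * (1 + 1 / δ) := by
        have e : ‖1 - t‖ ≤ 1 + ‖t‖ := by simpa using norm_sub_le (1:ℂ) t
        have e2 : 1 ≤ ‖t‖ * (1 / δ) := by
          rw [mul_one_div, le_div_iff₀ hδ]; linarith
        rw [zero_sub, norm_neg]
        linarith
      calc _ ≤ (‖0 - t‖ * (1 + 1 / δ)) * (‖(M.map (fun t => 0 - t)).prod‖ * (1 + 1 / δ) ^ M.card) := by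
            gcongr
        _ = _ := by ring
  have := gen P.roots hr
  rw [hsp.eval_eq_prod_roots, hsp.eval_eq_prod_roots, norm_mul, norm_mul]
  calc _ ≤ ‖P.leadingCoeff‖ * (‖(P.roots.map (fun t => 0 - t)).prod‖ * (1 + 1 / δ) ^ P.roots.card) := by gcongr
    _ ≤ ‖P.leadingCoeff‖ * (‖(P.roots.map (fun t => 0 - t)).prod‖ * (1 + 1 / δ) ^ D) := by
      gcongr
      rw [hcard]; exact hD
    _ = _ := by ring

lemma hform_continuous {n : ℕ} (κ : Fin n → ℕ) (c : ((i : Fin n) → Fin (κ i + 1)) → ℂ) :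
    Continuous (hform κ c) := by
  unfold hform
  fun_prop

lemma hform_line {n : ℕ} (κ : Fin n → ℕ) (c : ((i : Fin n) → Fin (κ i + 1)) → ℂ) (p d : Fin n → ℂ × ℂ) :
    ∃ P : Polynomial ℂ, P.natDegree ≤ ∑ i, κ i ∧ ∀ t : ℂ, P.eval t = hform κ c (p + t • d) := by
  refine ⟨∑ α : ((i : Fin n) → Fin (κ i + 1)), Polynomial.C (c α) * ∏ i,
    ((Polynomial.C (d i).1 * Polynomial.X + Polynomial.C (p i).1) ^ (α i : ℕ) *
    (Polynomial.C (d i).2 * Polynomial.X + Polynomial.C (p i).2) ^ (κ i - α i : ℕ)), ?_, ?_⟩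
  · refine Polynomial.natDegree_sum_le_of_forall_le _ _ fun α _ => ?_
    refine (Polynomial.natDegree_C_mul_le _ _).trans ?_
    refine (Polynomial.natDegree_prod_le _ _).trans ?_
    refine Finset.sum_le_sum fun i _ => ?_
    refine Polynomial.natDegree_mul_le.trans ?_
    have h1 := Polynomial.natDegree_pow_le_of_le (α i : ℕ) (Polynomial.natDegree_linear_le (a := (d i).1) (b := (p i).1))
    have h2 := Polynomial.natDegree_pow_le_of_le (κ i - α i : ℕ) (Polynomial.natDegree_linear_le (a := (d i).2) (b := (p i).2))
    have := (α i).2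
    omega
  · intro t
    unfold hform
    rw [Polynomial.eval_finsetSum]
    refine Finset.sum_congr rfl fun α _ => ?_
    simp [Polynomial.eval_prod]
    left
    refine Finset.prod_congr rfl fun i _ => ?_
    ring

lemma hurwitz {n : ℕ} (κ : Fin n → ℕ) (c : ((i : Fin n) → Fin (κ i + 1)) → ℂ) {ι : Type*} (l : Filter ι) [l.NeBot]
    (γ : ι → Fin n → ℂ × ℂ) (p d : Fin n → ℂ × ℂ) (hγ : Tendsto γ l (𝓝 p)) (δ : ℝ) (hδ : 0 < δ)
    (h : ∀ᶠ s in l, ∀ t : ℂ, ‖t‖ < δ → hform κ c (γ s + t • d) ≠ 0) (h0 : hform κ c p = 0) :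
    hform κ c (p + d) = 0 := by
  have hc := hform_continuous κ c
  have h1 : Tendsto (fun s => ‖hform κ c (γ s + d)‖) l (𝓝 ‖hform κ c (p + d)‖) :=
    ((hc.tendsto _).comp (hγ.add_const d)).norm
  have h2 : Tendsto (fun s => ‖hform κ c (γ s)‖ * (1 + 1 / δ) ^ (∑ i, κ i)) l
      (𝓝 (‖hform κ c p‖ * (1 + 1 / δ) ^ (∑ i, κ i))) :=
    ((hc.tendsto _).comp hγ).norm.mul_const _
  have := le_of_tendsto_of_tendsto h1 h2 (by
    filter_upwards [h] with s hs
    obtain ⟨P, hP, hP'⟩ := hform_line κ c (γ s) d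
    have := poly_growth P _ hP δ hδ (fun t ht => by rw [hP']; exact hs t ht)
    rw [hP', hP'] at this
    simpa using this)
  rw [h0] at this
  simpa using this

/-- scaling -/
lemma hform_smul {n : ℕ} (κ : Fin n → ℕ) (c : ((i : Fin n) → Fin (κ i + 1)) → ℂ) (p : Fin n → ℂ × ℂ) (l : Fin n → ℂ) :
    hform κ c (fun i => (l i * (p i).1, l i * (p i).2)) = (∏ i, l i ^ κ i) * hform κ c p := by
  unfold hform
  rw [Finset.mul_sum]
  refine Finset.sum_congr rfl fun α _ => ?_
  rw [mul_left_comm, ← Finset.prod_mul_distrib]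
  congr 1
  refine Finset.prod_congr rfl fun i _ => ?_
  have : l i ^ κ i = l i ^ (α i : ℕ) * l i ^ (κ i - α i : ℕ) := by
    rw [← pow_add]; congr 1; have := (α i).2; omega
  rw [this]; ring

/-- coefficients -/
noncomputable def toFs {n : ℕ} {κ : Fin n → ℕ} (α : (i : Fin n) → Fin (κ i + 1)) : Fin n →₀ ℕ :=
  Finsupp.equivFunOnFinite.symm (fun i => (α i : ℕ))

noncomputable def cf {n : ℕ} (κ : Fin n → ℕ) (f : MvPolynomial (Fin n) ℂ) (α : (i : Fin n) → Fin (κ i + 1)) : ℂ :=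
  coeff (toFs α) f

lemma sum_Iic {n : ℕ} (κ : Fin n →₀ ℕ) (φ : (Fin n →₀ ℕ) → ℂ) :
    ∑ α ∈ Finset.Iic κ, φ α = ∑ α : (i : Fin n) → Fin (κ i + 1), φ (toFs α) := by
  symm
  refine Finset.sum_bij (fun α _ => toFs α) ?_ ?_ ?_ ?_
  · intro α _
    rw [Finset.mem_Iic]
    intro i
    have := (α i).2
    simp [toFs]; omega
  · intro α _ β _ h
    funext i
    have := DFunLike.congr_fun h i
    simp [toFs] at this
    exact Fin.ext this
  · intro α hα
    rw [Finset.mem_Iic] at hα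
    refine ⟨fun i => ⟨α i, Nat.lt_succ_of_le (hα i)⟩, Finset.mem_univ _, ?_⟩
    ext i; simp [toFs]
  · intros; rfl

lemma eval_eq_hform {n : ℕ} (κ : Fin n →₀ ℕ) (f : MvPolynomial (Fin n) ℂ) (hf : ∀ i, f.degreeOf i ≤ κ i)
    (z : Fin n → ℂ) : eval z f = hform κ (cf κ f) (fun i => (z i, 1)) := by
  have h1 : eval z f = ∑ α ∈ Finset.Iic κ, coeff α f * ∏ i, z i ^ α i := by
    rw [eval_eq']
    refine Finset.sum_subset ?_ ?_
    · intro α hα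
      rw [Finset.mem_Iic]
      intro i
      exact (monomial_le_degreeOf i hα).trans (hf i)
    · intro α _ hα
      rw [notMem_support_iff.1 hα, zero_mul]
  rw [h1, sum_Iic]
  unfold hform cf
  refine Finset.sum_congr rfl fun α _ => ?_
  simp [toFs]

lemma hform_affine {n : ℕ} (κ : Fin n →₀ ℕ) (f : MvPolynomial (Fin n) ℂ) (hf : ∀ i, f.degreeOf i ≤ κ i)
    (p : Fin n → ℂ × ℂ) (hp : ∀ i, (p i).2 ≠ 0) (h : eval (fun i => (p i).1 / (p i).2) f ≠ 0) :
    hform κ (cf κ f) p ≠ 0 := by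
  rw [eval_eq_hform κ f hf] at h
  have := hform_smul κ (cf κ f) (fun i => ((p i).1 / (p i).2, 1)) (fun i => (p i).2)
  have e : (fun i => ((p i).2 * ((p i).1 / (p i).2, (1:ℂ)).1, (p i).2 * ((p i).1 / (p i).2, (1:ℂ)).2)) = p := by
    funext i
    ext
    · simp; field_simp [hp i]
    · simp
  rw [e] at this
  rw [this]
  exact mul_ne_zero (Finset.prod_ne_zero_iff.2 fun i _ => pow_ne_zero _ (hp i)) h

/-- the leading part in the variable `j` is nonzero -/
lemma lead_ne {n : ℕ} (κ : Fin n →₀ ℕ) (f : MvPolynomial (Fin n) ℂ) (hf : ∀ i, f.degreeOf i ≤ κ i) (hf0 : f ≠ 0)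
    (j : Fin n) (hj : f.degreeOf j = κ j) (x : ℂ) :
    ∃ q : Fin n → ℂ × ℂ, q j = (x, 0) ∧ (x ≠ 0 → hform κ (cf κ f) q ≠ 0) := by
  by_contra hc
  push Not at hc
  obtain ⟨α, hα, hαj⟩ : ∃ α ∈ f.support, α j = κ j := by
    rw [degreeOf_eq_sup] at hj
    obtain ⟨α, hα, h⟩ := Finset.exists_mem_eq_sup f.support (MvPolynomial.support_nonempty.2 hf0) (fun m => m j)
    exact ⟨α, hα, by rw [← hj, h]⟩
  set g : MvPolynomial (Fin n) ℂ := ∑ β ∈ (Finset.Iic κ).filter (fun β => β j = κ j), monomial β (coeff β f) with hg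
  have hg0 : g = 0 := by
    apply MvPolynomial.funext
    intro z
    obtain ⟨hx, h0⟩ := hc (Function.update (fun i => (z i, (1:ℂ))) j (x, 0)) (by simp)
    have h1 := hform_smul κ (cf κ f) (Function.update (fun i => (z i, (1:ℂ))) j (x, 0))
      (Function.update (fun _ => (1:ℂ)) j (z j / x))
    rw [h0, mul_zero] at h1
    have hz : (fun i => ((Function.update (fun _ => (1:ℂ)) j (z j / x)) i * ((Function.update (fun i => (z i, (1:ℂ))) j (x, 0)) i).1,
       (Function.update (fun _ => (1:ℂ)) j (z j / x)) i * ((Function.update (fun i => (z i, (1:ℂ))) j (x, 0)) i).2))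
       = fun i => (z i, if i = j then 0 else 1) := by
      funext i
      by_cases hij : i = j
      · subst hij; simp; field_simp
      · simp [hij]
    rw [hz] at h1
    rw [map_zero, ← h1, hg, map_sum, Finset.sum_filter, sum_Iic]
    unfold hform
    refine Finset.sum_congr rfl fun α _ => ?_
    split_ifs with hs
    · rw [eval_monomial, cf, Finsupp.prod_fintype _ _ (by simp)]
      congr 1
      refine Finset.prod_congr rfl fun i _ => ?_
      by_cases hij : i = j
      · subst hij
        have : κ i - (α i : ℕ) = 0 := by simp [toFs] at hs; omega
        rw [this]; simp [toFs]
      · simp [hij, toFs]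
    · symm
      apply mul_eq_zero_of_right
      refine Finset.prod_eq_zero (Finset.mem_univ j) ?_
      have : κ j - (α j : ℕ) ≠ 0 := by
        have := (α j).2
        simp [toFs] at hs; omega
      simp [this]
  have : coeff α g = coeff α f := by
    rw [hg, coeff_sum]
    rw [Finset.sum_eq_single α]
    · simp
    · intro b _ hb; simp [coeff_monomial, hb]
    · intro h
      exfalso; apply h
      simp only [Finset.mem_filter, Finset.mem_Iic]
      exact ⟨fun i => (monomial_le_degreeOf i hα).trans (hf i), hαj⟩
  rw [hg0] at this
  exact (mem_support_iff.1 hα) (by rw [← this]; simp)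

end

section
open MvPolynomial Filter Topology

lemma IsHerm.zero {Q} (h : IsHerm Q) : Q 0 = 0 := by
  have := h.smul 0 0
  simp only [zero_mul, Complex.normSq_zero] at this
  exact this

lemma IsHerm.dehom {Q} (h : IsHerm Q) (p : ℂ × ℂ) (hp : p.2 ≠ 0) :
    Q (p.1 / p.2, 1) = Complex.normSq p.2⁻¹ * Q p := by
  rw [← h.smul]
  congr 2
  · rw [div_eq_inv_mul]
  · rw [inv_mul_cancel₀ hp]

lemma ext_open {n : ℕ} (κ : Fin n →₀ ℕ) (f : MvPolynomial (Fin n) ℂ) (hf : ∀ i, f.degreeOf i ≤ κ i) (hf0 : f ≠ 0)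
    (Q : Fin n → ℂ × ℂ → ℝ) (hQ : ∀ i, IsHerm (Q i))
    (hs : ∀ z : Fin n → ℂ, (∀ i, Q i (z i, 1) < 0) → eval z f ≠ 0)
    (hd : ∀ j, (∃ x, Q j (x, 0) < 0) → f.degreeOf j = κ j) (p : Fin n → ℂ × ℂ) (hp : ∀ i, Q i (p i) < 0) :
    hform κ (cf κ f) p ≠ 0 := by
  have claim : ∀ S : Finset (Fin n), ∀ p : Fin n → ℂ × ℂ, (∀ i, Q i (p i) < 0) → (∀ i, i ∉ S → (p i).2 ≠ 0) →
      hform κ (cf κ f) p ≠ 0 := by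
    intro S
    induction S using Finset.induction with
    | empty =>
      intro p hp hp2
      have hp2' : ∀ i, (p i).2 ≠ 0 := fun i => hp2 i (by simp)
      refine hform_affine κ f hf p hp2' (hs _ fun i => ?_)
      rw [(hQ i).dehom _ (hp2' i)]
      exact mul_neg_of_pos_of_neg (Complex.normSq_pos.2 (inv_ne_zero (hp2' i))) (hp i)
    | insert j S hj ih =>
      intro p hp hp2
      by_cases hpj : (p j).2 = 0
      swap
      · refine ih p hp fun i hi => ?_
        by_cases hij : i = j
        · subst hij; exact hpj
        · exact hp2 i (by simp [hij, hi])
      set x := (p j).1 with hx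
      have hpx : p j = (x, 0) := by ext <;> simp [hx, hpj]
      have hx0 : x ≠ 0 := by
        intro h0
        have := hp j
        rw [hpx, h0] at this
        have h1 := (hQ j).zero
        rw [show ((0:ℂ), (0:ℂ)) = 0 from rfl] at this
        linarith
      obtain ⟨q, hq, hq0⟩ := lead_ne κ f hf hf0 j (hd j ⟨x, by rw [← hpx]; exact hp j⟩) x
      intro h0
      have hc : Continuous (fun st : ℂ × ℂ => Function.update p j (x, st.1) + st.2 • (q - p)) := by
        have : Continuous (fun st : ℂ × ℂ => Function.update p j (x, st.1)) :=
          continuous_const.update j (by fun_prop)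
        fun_prop
      have hN : ∀ᶠ st : ℂ × ℂ in 𝓝 (0, 0), ∀ i,
          Q i ((Function.update p j (x, st.1) + st.2 • (q - p)) i) < 0 ∧
          (i ∉ insert j S → ((Function.update p j (x, st.1) + st.2 • (q - p)) i).2 ≠ 0) := by
        rw [eventually_all]
        intro i
        have e0 : (Function.update p j (x, (0:ℂ)) + (0:ℂ) • (q - p)) = p := by
          rw [← hpx]; simp
        have c1 : Continuous (fun st : ℂ × ℂ => (Function.update p j (x, st.1) + st.2 • (q - p)) i) :=
          (continuous_apply i).comp hc
        refine Filter.Eventually.and ?_ ?_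
        · have := ((hQ i).continuous.comp c1).continuousAt (x := ((0:ℂ), (0:ℂ)))
          refine this.eventually_lt_const ?_
          simp only [Function.comp_apply]
          rw [e0]; exact hp i
        · by_cases hi : i ∈ insert j S
          · simp [hi]
          · have := (continuous_snd.comp c1).continuousAt (x := ((0:ℂ), (0:ℂ)))
            have := this.eventually_ne (y := 0) (by
              simp only [Function.comp_apply]
              rw [e0]; exact hp2 i hi)
            filter_upwards [this] with st h _
            exact h
      obtain ⟨δ, hδ, hball⟩ := Metric.eventually_nhds_iff.1 hN
      have := hurwitz κ (cf κ f) (𝓝[≠] (0:ℂ)) (fun s => Function.update p j (x, s)) p (q - p) (by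
          have : Continuous (fun s : ℂ => Function.update p j (x, s)) :=
            continuous_const.update j (by fun_prop)
          have := this.tendsto 0
          rw [← hpx] at this
          simp only [Function.update_eq_self] at this
          exact this.mono_left nhdsWithin_le_nhds) δ hδ (by
          have e1 : ∀ᶠ s in 𝓝[≠] (0:ℂ), dist s 0 < δ :=
            nhdsWithin_le_nhds (Metric.ball_mem_nhds 0 hδ)
          have e2 : ∀ᶠ s in 𝓝[≠] (0:ℂ), s ≠ 0 := eventually_mem_nhdsWithin
          filter_upwards [e1, e2] with s hs1 hs2 t ht
          have hh := @hball (s, t) (by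
            rw [Prod.dist_eq]; simp only [max_lt_iff]
            exact ⟨hs1, by simpa using ht⟩)
          refine ih _ (fun i => (hh i).1) (fun i hi => ?_)
          by_cases hij : i = j
          · subst hij
            simp [hq, hpx, hs2]
          · exact (hh i).2 (by simp [hij, hi])) h0
      rw [add_sub_cancel] at this
      exact hq0 hx0 this
  exact claim Finset.univ p hp (by simp)

lemma ext_closed {n : ℕ} (κ : Fin n →₀ ℕ) (f : MvPolynomial (Fin n) ℂ) (hf : ∀ i, f.degreeOf i ≤ κ i) (hf0 : f ≠ 0)
    (Q : Fin n → ℂ × ℂ → ℝ) (hQ : ∀ i, IsHerm (Q i))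
    (hs : ∀ z : Fin n → ℂ, (∀ i, 0 ≤ Q i (z i, 1)) → eval z f ≠ 0)
    (hd : ∀ j, (∃ x, 0 < Q j (x, 0)) → f.degreeOf j = κ j)
    (hap : ∀ i, ∀ p : ℂ × ℂ, p.2 ≠ 0 → 0 ≤ Q i p → ∃ γ : ℝ → ℂ × ℂ, Tendsto γ (𝓝[>] 0) (𝓝 p) ∧
      ∀ᶠ s in 𝓝[>] 0, 0 < Q i (γ s))
    (hinf : ∀ i, ∀ p : ℂ × ℂ, p ≠ 0 → p.2 = 0 → 0 ≤ Q i p → 0 < Q i p)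
    (p : Fin n → ℂ × ℂ) (hp0 : ∀ i, p i ≠ 0) (hp : ∀ i, 0 ≤ Q i (p i)) :
    hform κ (cf κ f) p ≠ 0 := by
  have hopen : ∀ p : Fin n → ℂ × ℂ, (∀ i, 0 < Q i (p i)) → hform κ (cf κ f) p ≠ 0 := by
    intro p hp
    refine ext_open κ f hf hf0 (fun i p => - Q i p) (fun i => (hQ i).neg) ?_ ?_ p (fun i => by simpa using hp i)
    · intro z hz
      exact hs z fun i => by have := hz i; linarith
    · rintro j ⟨x, hx⟩
      exact hd j ⟨x, by linarith⟩
  have hγ : ∀ i, ∃ γ : ℝ → ℂ × ℂ, Tendsto γ (𝓝[>] 0) (𝓝 (p i)) ∧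
      (∀ᶠ s in 𝓝[>] 0, 0 < Q i (γ s)) ∧ ((p i).2 = 0 → ∀ s, γ s = p i) := by
    intro i
    by_cases h : (p i).2 = 0
    · exact ⟨fun _ => p i, tendsto_const_nhds, Eventually.of_forall fun _ => hinf i _ (hp0 i) h (hp i), fun _ _ => rfl⟩
    · obtain ⟨γ, h1, h2⟩ := hap i (p i) h (hp i)
      exact ⟨γ, h1, h2, fun h' => absurd h' h⟩
  choose γ hγ1 hγ2 hγ3 using hγ
  have hη : ∀ i, ∃ d : ℂ × ℂ, ((p i).2 ≠ 0 → d = 0) ∧ (p i + d).2 ≠ 0 ∧ 0 ≤ Q i (p i + d) := by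
    intro i
    by_cases h : (p i).2 = 0
    · have hc : Continuous (fun s : ℂ => Q i (p i + (0, s))) := (hQ i).continuous.comp (by fun_prop)
      have h1 : ∀ᶠ s in 𝓝[≠] (0:ℂ), 0 < Q i (p i + (0, s)) := by
        apply nhdsWithin_le_nhds
        refine hc.continuousAt.eventually_const_lt ?_
        have : p i + (0, 0) = p i := by ext <;> simp
        change 0 < Q i (p i + (0, 0))
        rw [this]
        exact hinf i _ (hp0 i) h (hp i)
      have e2 : ∀ᶠ s in 𝓝[≠] (0:ℂ), s ≠ 0 := eventually_mem_nhdsWithin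
      obtain ⟨s, hs1, hs2⟩ := (h1.and e2).exists
      exact ⟨(0, s), fun h' => absurd h h', by simpa [h] using hs2, hs1.le⟩
    · exact ⟨0, fun _ => rfl, by simpa using h, by simpa using hp i⟩
  choose d hd1 hd2 hd3 using hη
  intro h0
  have hN : ∀ᶠ t : ℂ in 𝓝 0, ∀ i, (p i).2 = 0 → 0 < Q i (p i + t • d i) := by
    rw [eventually_all]
    intro i
    by_cases h : (p i).2 = 0
    · have hc : Continuous (fun t : ℂ => Q i (p i + t • d i)) := (hQ i).continuous.comp (by fun_prop)
      have := (hc.continuousAt (x := 0)).eventually_const_lt (u := 0) (by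
        simpa using hinf i _ (hp0 i) h (hp i))
      filter_upwards [this] with t ht _
      exact ht
    · simp [h]
  obtain ⟨δ, hδ, hball⟩ := Metric.eventually_nhds_iff.1 hN
  have := hurwitz κ (cf κ f) (𝓝[>] (0:ℝ)) (fun s i => γ i s) p d (tendsto_pi_nhds.2 hγ1) δ hδ (by
    filter_upwards [eventually_all.2 hγ2] with s hs t ht
    apply hopen
    intro i
    by_cases h : (p i).2 = 0
    · have := hball (y := t) (by simpa using ht) i h
      simpa [hγ3 i h s] using this
    · simpa [hd1 i h] using hs i) h0
  refine hform_affine κ f hf (p + d) (fun i => hd2 i) (hs _ fun i => ?_) this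
  have h3 := (hQ i).dehom (p i + d i) (hd2 i)
  rw [show (p + d) i = p i + d i from rfl, h3]
  exact mul_nonneg (Complex.normSq_nonneg _) (hd3 i)

lemma slack {n : ℕ} (κ : Fin n → ℕ) (c : ((i : Fin n) → Fin (κ i + 1)) → ℂ)
    (Q : Fin n → ℂ × ℂ → ℝ) (hQ : ∀ i, IsHerm (Q i))
    (h : ∀ p : Fin n → ℂ × ℂ, (∀ i, p i ≠ 0) → (∀ i, 0 ≤ Q i (p i)) → hform κ c p ≠ 0) :
    ∃ ε > 0, ∀ p : Fin n → ℂ × ℂ,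
      (∀ i, -(Q i (p i) + ε * (Complex.normSq (p i).1 + Complex.normSq (p i).2)) < 0) → hform κ c p ≠ 0 := by
  set N : ℂ × ℂ → ℝ := fun q => Complex.normSq q.1 + Complex.normSq q.2 with hN
  have hNc : Continuous N := by
    have := Complex.continuous_normSq
    fun_prop
  set Z : Set (Fin n → ℂ × ℂ) := {q | (∀ i, N (q i) = 1) ∧ hform κ c q = 0} with hZ
  have hZc : IsCompact Z := by
    apply Metric.isCompact_of_isClosed_isBounded
    · have : Z = (⋂ i, {q | N (q i) = 1}) ∩ {q | hform κ c q = 0} := by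
        ext q; simp [hZ]
      rw [this]
      refine IsClosed.inter (isClosed_iInter fun i => isClosed_eq (hNc.comp (continuous_apply i)) continuous_const)
        (isClosed_eq (hform_continuous κ c) continuous_const)
    · refine (Metric.isBounded_closedBall (x := 0) (r := 1)).subset ?_
      intro q hq
      rw [mem_closedBall_zero_iff, pi_norm_le_iff_of_nonneg zero_le_one]
      intro i
      have := hq.1 i
      simp only [hN, Complex.normSq_eq_norm_sq] at this
      rw [Prod.norm_def, max_le_iff]
      constructor <;> nlinarith [sq_nonneg ‖(q i).1‖, sq_nonneg ‖(q i).2‖, norm_nonneg (q i).1, norm_nonneg (q i).2]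
  have main : ∃ ε > 0, ∀ q ∈ Z, ∃ i, Q i (q i) ≤ -ε := by
    rcases Z.eq_empty_or_nonempty with he | hne
    · exact ⟨1, one_pos, by simp [he]⟩
    · have hmc : Continuous (fun q : Fin n → ℂ × ℂ => ∑ i, max 0 (- Q i (q i))) := by
        have : ∀ i, Continuous (fun q : Fin n → ℂ × ℂ => Q i (q i)) := fun i => (hQ i).continuous.comp (continuous_apply i)
        exact continuous_finsetSum _ fun i _ => continuous_const.max (this i).neg
      obtain ⟨q0, hq0, hmin⟩ := hZc.exists_isMinOn hne hmc.continuousOn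
      have hpos : 0 < ∑ i, max 0 (- Q i (q0 i)) := by
        have : ∃ i, Q i (q0 i) < 0 := by
          by_contra hcon
          push Not at hcon
          refine h q0 (fun i h0 => ?_) hcon hq0.2
          have := hq0.1 i
          simp [hN, h0] at this
        obtain ⟨i, hi⟩ := this
        refine Finset.sum_pos' (fun i _ => le_max_left _ _) ⟨i, Finset.mem_univ _, ?_⟩
        exact lt_max_of_lt_right (by linarith)
      set m := ∑ i, max 0 (- Q i (q0 i)) with hm
      refine ⟨m / (n + 1), by positivity, fun q hq => ?_⟩
      by_contra hcon
      push Not at hcon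
      have h1 : m ≤ ∑ i, max 0 (- Q i (q i)) := hmin hq
      have h2 : ∑ i, max 0 (- Q i (q i)) ≤ ∑ i : Fin n, m / (n + 1) := by
        refine Finset.sum_le_sum fun i _ => ?_
        have := hcon i
        exact max_le (by positivity) (by linarith)
      rw [Finset.sum_const, Finset.card_univ, Fintype.card_fin, nsmul_eq_mul] at h2
      have h3 : (n : ℝ) * (m / (n + 1)) < m := by
        rw [mul_div_assoc', div_lt_iff₀ (by positivity)]
        nlinarith
      linarith
  obtain ⟨ε, hε, hmain⟩ := main
  refine ⟨ε, hε, fun p hp h0 => ?_⟩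
  have hNpos : ∀ i, 0 < N (p i) := by
    intro i
    have h1 : 0 ≤ N (p i) := add_nonneg (Complex.normSq_nonneg _) (Complex.normSq_nonneg _)
    rcases h1.lt_or_eq with h2 | h2
    · exact h2
    · exfalso
      have h3 : Complex.normSq (p i).1 = 0 ∧ Complex.normSq (p i).2 = 0 := by
        have a1 := Complex.normSq_nonneg (p i).1
        have a2 := Complex.normSq_nonneg (p i).2
        simp only [hN] at h2
        constructor <;> linarith
      have h4 : p i = 0 := by ext1 <;> simpa using (by first | exact Complex.normSq_eq_zero.1 h3.1 | exact Complex.normSq_eq_zero.1 h3.2)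
      have := hp i
      rw [h4, (hQ i).zero] at this
      simp at this
  set l : Fin n → ℂ := fun i => (((Real.sqrt (N (p i)))⁻¹ : ℝ) : ℂ) with hl
  have hln : ∀ i, Complex.normSq (l i) = (N (p i))⁻¹ := by
    intro i
    rw [hl]; simp only [Complex.normSq_ofReal]
    rw [← mul_inv, Real.mul_self_sqrt (hNpos i).le]
  obtain ⟨i, hi⟩ := hmain (fun i => (l i * (p i).1, l i * (p i).2)) ⟨fun i => by
      simp only [hN, Complex.normSq_mul, ← mul_add, hln]
      exact inv_mul_cancel₀ (hNpos i).ne', by rw [hform_smul, h0, mul_zero]⟩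
  rw [(hQ i).smul, hln] at hi
  have h1 := hp i
  have h2 := hNpos i
  change -(Q i (p i) + ε * N (p i)) < 0 at h1
  rw [inv_mul_le_iff₀ h2] at hi
  linarith

end

section
open MvPolynomial Filter Topology

lemma coeff_pd_pow {n : ℕ} (i : Fin n) (k : ℕ) : ∀ (f : MvPolynomial (Fin n) ℂ) (β : Fin n →₀ ℕ),
    coeff β ((((pderiv i : Derivation ℂ (MvPolynomial (Fin n) ℂ)
      (MvPolynomial (Fin n) ℂ)).toLinearMap) ^ k) f) =
    coeff (β + Finsupp.single i k) f * ((β i + 1).ascFactorial k : ℂ) := by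
  induction k with
  | zero => intro f β; simp
  | succ k ih =>
    intro f β
    rw [pow_succ, Module.End.mul_apply, ih]
    change coeff _ (pderiv i f) * _ = _
    rw [coeff_pderiv, Nat.ascFactorial_succ, add_assoc, ← Finsupp.single_add]
    simp
    ring

lemma coeff_pd_list {n : ℕ} (α : Fin n →₀ ℕ) (f : MvPolynomial (Fin n) ℂ) (l : List (Fin n)) (hl : l.Nodup) :
    ∀ β : Fin n →₀ ℕ, coeff β ((l.map fun i => ((pderiv i : Derivation ℂ (MvPolynomial (Fin n) ℂ)
      (MvPolynomial (Fin n) ℂ)).toLinearMap) ^ (α i)).prod f) =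
    coeff (β + (l.map fun i => Finsupp.single i (α i)).sum) f *
      (l.map fun i => ((β i + 1).ascFactorial (α i) : ℂ)).prod := by
  induction l with
  | nil => intro β; simp
  | cons i l ih =>
    intro β
    rw [List.nodup_cons] at hl
    rw [List.map_cons, List.prod_cons, Module.End.mul_apply, coeff_pd_pow, ih hl.2]
    simp only [List.map_cons, List.sum_cons, List.prod_cons]
    have : (l.map fun j => ((((β + Finsupp.single i (α i)) : Fin n →₀ ℕ) j + 1).ascFactorial (α j) : ℂ)) =
        (l.map fun j => ((β j + 1).ascFactorial (α j) : ℂ)) := by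
      apply List.map_congr_left
      intro j hj
      have : i ≠ j := by rintro rfl; exact hl.1 hj
      simp [Finsupp.single_apply, this]
    rw [this, add_assoc]
    ring

lemma eval_pdPow {n : ℕ} (α : Fin n →₀ ℕ) (f : MvPolynomial (Fin n) ℂ) :
    eval 0 (pdPow α f) = coeff α f * ∏ i, ((α i).factorial : ℂ) := by
  rw [MvPolynomial.eval_zero, constantCoeff_eq, pdPow, List.ofFn_eq_map, coeff_pd_list α f _ (List.nodup_finRange n)]
  have e1 : ((List.finRange n).map fun i => Finsupp.single i (α i)).sum = α := by
    rw [← List.ofFn_eq_map, List.sum_ofFn]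
    exact Finsupp.univ_sum_single α
  have e2 : ((List.finRange n).map fun i => ((((0 : Fin n →₀ ℕ) i) + 1).ascFactorial (α i) : ℂ)).prod
      = ∏ i, ((α i).factorial : ℂ) := by
    rw [← List.ofFn_eq_map, List.prod_ofFn]
    simp [Nat.one_ascFactorial]
  rw [e1, e2, zero_add]

lemma apolar_eq {n : ℕ} (κ : Fin n →₀ ℕ) (f g : MvPolynomial (Fin n) ℂ) :
    apolarForm κ f g = ∑ α : (i : Fin n) → Fin (κ i + 1),
      (∏ i, ((-1) ^ (α i : ℕ) * ((α i : ℕ).factorial : ℂ) * ((κ i - α i : ℕ).factorial : ℂ)))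
      * (cf κ f α * cf κ g (fun i => (α i).rev)) := by
  rw [apolarForm, sum_Iic]
  refine Finset.sum_congr rfl fun α _ => ?_
  rw [eval_pdPow, eval_pdPow]
  have e : κ - toFs α = toFs (fun i => (α i).rev) := by
    ext i; simp [toFs, Fin.val_rev]
  rw [e, cf, cf, Finset.prod_mul_distrib, Finset.prod_mul_distrib, ← Finset.prod_pow_eq_pow_sum]
  have e3 : ∀ i, (toFs (fun i => (α i).rev) : Fin n →₀ ℕ) i = κ i - α i := by
    intro i; simp [toFs, Fin.val_rev]
  have e4 : ∀ i, (toFs α) i = α i := by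
    intro i; simp [toFs]
  simp only [e3, e4]
  ring

lemma region (C : Set ℂ) (hC : (∃ w r, 0 < r ∧ C = Metric.ball w r) ∨
      (∃ w r, 0 < r ∧ C = (Metric.closedBall w r)ᶜ)) :
    ∃ Q : ℂ × ℂ → ℝ, IsHerm Q ∧ (∀ z, z ∈ C ↔ Q (z, 1) < 0) ∧
    (∀ p : ℂ × ℂ, p.2 ≠ 0 → 0 ≤ Q p → ∃ γ : ℝ → ℂ × ℂ, Tendsto γ (𝓝[>] 0) (𝓝 p) ∧
      ∀ᶠ s in 𝓝[>] 0, 0 < Q (γ s)) ∧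
    (∀ p : ℂ × ℂ, p ≠ 0 → p.2 = 0 → 0 ≤ Q p → 0 < Q p) ∧
    ((∃ x, Q (x, 0) < 0) → (∃ w r, 0 < r ∧ C = (Metric.closedBall w r)ᶜ)) ∧
    ((∃ x, 0 < Q (x, 0)) → (∃ w r, 0 < r ∧ C = Metric.ball w r)) ∧
    (∀ ε > 0, ∃ w : ℂ × ℂ, -(Q w + ε * (Complex.normSq w.1 + Complex.normSq w.2)) < 0 ∧ Q w < 0) ∧
    (∃ z, z ∈ C) ∧ (∃ z, z ∈ Cᶜ) := by
  have hball : ∀ (w : ℂ) (r : ℝ), 0 < r → ∀ z, (dist z w < r ↔ Complex.normSq (z - w) < r ^ 2) := by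
    intro w r hr z
    rw [dist_eq_norm, Complex.normSq_eq_norm_sq, sq_lt_sq₀ (norm_nonneg _) hr.le]
  have hball' : ∀ (w : ℂ) (r : ℝ), 0 < r → ∀ z, (r < dist z w ↔ r ^ 2 < Complex.normSq (z - w)) := by
    intro w r hr z
    rw [dist_eq_norm, Complex.normSq_eq_norm_sq, sq_lt_sq₀ hr.le (norm_nonneg _)]
  rcases hC with ⟨w, r, hr, rfl⟩ | ⟨w, r, hr, rfl⟩
  · refine ⟨fun p => Complex.normSq (p.1 - w * p.2) - r ^ 2 * Complex.normSq p.2, ?_, ?_, ?_, ?_, ?_, ?_, ?_, ?_, ?_⟩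
    · refine ⟨1, Complex.normSq w - r ^ 2, - (starRingEnd ℂ) w, fun p => ?_⟩
      simp [Complex.normSq_apply]; ring
    · intro z
      rw [Metric.mem_ball, hball w r hr]
      simp
    · intro p hp hq
      refine ⟨fun s => (p.1 + s * (p.1 - w * p.2), p.2), ?_, ?_⟩
      · have : Continuous (fun s : ℝ => (p.1 + s * (p.1 - w * p.2), p.2)) := by fun_prop
        have := this.tendsto 0
        simp only [Complex.ofReal_zero, zero_mul, add_zero] at this
        exact this.mono_left nhdsWithin_le_nhds
      · filter_upwards [self_mem_nhdsWithin] with s hs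
        have hs : 0 < s := hs
        have e : p.1 + s * (p.1 - w * p.2) - w * p.2 = ((1 + s : ℝ) : ℂ) * (p.1 - w * p.2) := by push_cast; ring
        simp only [e, Complex.normSq_mul, Complex.normSq_ofReal]
        have h1 : 0 < r ^ 2 * Complex.normSq p.2 := mul_pos (by positivity) (Complex.normSq_pos.2 hp)
        nlinarith [mul_pos hs hs]
    · intro p hp hp2 _
      have : p.1 ≠ 0 := fun h => hp (Prod.ext h hp2)
      simpa [hp2] using this
    · rintro ⟨x, hx⟩
      exfalso
      simp at hx
      linarith [Complex.normSq_nonneg x]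
    · intro _; exact ⟨w, r, hr, rfl⟩
    · intro ε hε
      have hc : Continuous (fun t : ℝ => r ^ 2 * (t ^ 2 - 1) + ε) := by fun_prop
      have h1 : ∀ᶠ t in 𝓝[<] (1:ℝ), 0 < r ^ 2 * (t ^ 2 - 1) + ε :=
        nhdsWithin_le_nhds ((hc.continuousAt (x := 1)).eventually_const_lt (by simpa using hε))
      have h2 : ∀ᶠ t in 𝓝[<] (1:ℝ), (0:ℝ) < t := nhdsWithin_le_nhds (eventually_gt_nhds one_pos)
      have h3 : ∀ᶠ t in 𝓝[<] (1:ℝ), t < 1 := eventually_mem_nhdsWithin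
      obtain ⟨t, h1, h2, h3⟩ := (h1.and (h2.and h3)).exists
      refine ⟨(w + ((r * t : ℝ) : ℂ), 1), ?_, ?_⟩
      · have := Complex.normSq_nonneg (w + ((r * t : ℝ) : ℂ))
        simp only [mul_one, add_sub_cancel_left, Complex.normSq_one, Complex.normSq_ofReal]
        nlinarith [mul_nonneg hε.le this]
      · simp only [mul_one, add_sub_cancel_left, Complex.normSq_one, Complex.normSq_ofReal]
        have : 0 < r ^ 2 := by positivity
        have : t * t < 1 := by nlinarith
        nlinarith
    · exact ⟨w, by simpa using hr⟩
    · exact ⟨w + r, by simp [abs_of_pos hr]⟩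
  · refine ⟨fun p => r ^ 2 * Complex.normSq p.2 - Complex.normSq (p.1 - w * p.2), ?_, ?_, ?_, ?_, ?_, ?_, ?_, ?_, ?_⟩
    · refine ⟨-1, r ^ 2 - Complex.normSq w, (starRingEnd ℂ) w, fun p => ?_⟩
      simp [Complex.normSq_apply]; ring
    · intro z
      rw [Set.mem_compl_iff, Metric.mem_closedBall, not_le, hball' w r hr]
      simp
    · intro p hp hq
      refine ⟨fun s => (p.1 - s * (p.1 - w * p.2), p.2), ?_, ?_⟩
      · have : Continuous (fun s : ℝ => (p.1 - s * (p.1 - w * p.2), p.2)) := by fun_prop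
        have := this.tendsto 0
        simp only [Complex.ofReal_zero, zero_mul, sub_zero] at this
        exact this.mono_left nhdsWithin_le_nhds
      · filter_upwards [self_mem_nhdsWithin, nhdsWithin_le_nhds (eventually_lt_nhds one_pos)] with s hs hs1
        have hs : 0 < s := hs
        have e : p.1 - s * (p.1 - w * p.2) - w * p.2 = ((1 - s : ℝ) : ℂ) * (p.1 - w * p.2) := by push_cast; ring
        simp only [e, Complex.normSq_mul, Complex.normSq_ofReal]
        have h1 : 0 < r ^ 2 * Complex.normSq p.2 := mul_pos (by positivity) (Complex.normSq_pos.2 hp)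
        have h2 := Complex.normSq_nonneg (p.1 - w * p.2)
        have h3 : (1 - s) * (1 - s) < 1 := by nlinarith
        rcases h2.eq_or_lt with h4 | h4
        · rw [← h4]; linarith
        · nlinarith
    · intro p hp hp2 hh
      exfalso
      have : p.1 ≠ 0 := fun h => hp (Prod.ext h hp2)
      have := Complex.normSq_pos.2 this
      simp [hp2] at hh
      linarith
    · intro _; exact ⟨w, r, hr, rfl⟩
    · rintro ⟨x, hx⟩
      exfalso
      simp at hx
      linarith [Complex.normSq_nonneg x]
    · intro ε hε
      have hc : Continuous (fun t : ℝ => r ^ 2 * (1 - t ^ 2) + ε) := by fun_prop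
      have h1 : ∀ᶠ t in 𝓝[>] (1:ℝ), 0 < r ^ 2 * (1 - t ^ 2) + ε :=
        nhdsWithin_le_nhds ((hc.continuousAt (x := 1)).eventually_const_lt (by simpa using hε))
      have h3 : ∀ᶠ t in 𝓝[>] (1:ℝ), 1 < t := eventually_mem_nhdsWithin
      obtain ⟨t, h1, h3⟩ := (h1.and h3).exists
      refine ⟨(w + ((r * t : ℝ) : ℂ), 1), ?_, ?_⟩
      · have := Complex.normSq_nonneg (w + ((r * t : ℝ) : ℂ))
        simp only [mul_one, add_sub_cancel_left, Complex.normSq_one, Complex.normSq_ofReal]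
        nlinarith [mul_nonneg hε.le this]
      · simp only [mul_one, add_sub_cancel_left, Complex.normSq_one, Complex.normSq_ofReal]
        have : 0 < r ^ 2 := by positivity
        have : 1 < t * t := by nlinarith
        nlinarith
    · refine ⟨w + (2 * r : ℝ), ?_⟩
      simp only [Set.mem_compl_iff, Metric.mem_closedBall, dist_self_add_left, Complex.norm_real, Real.norm_eq_abs, not_le]
      rw [abs_of_pos (by positivity)]; linarith
    · exact ⟨w, by simpa using hr.le⟩

end

/-- **Multivariate Grace apolarity theorem for discs and exteriors of discs.**
Let each `C i` be an open disc or the open exterior of a closed disc, and let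
`f, g ∈ ℂ_κ[z₁,…,zₙ]`. If `f` is `C₁×⋯×Cₙ`-stable with `deg_{z_j} f = κ_j` whenever
`C j` is an exterior of a disc, and `g` is `(ℂ∖C₁)×⋯×(ℂ∖Cₙ)`-stable with
`deg_{z_j} g = κ_j` whenever `C j` is a disc, then `{f,g}_κ ≠ 0`. -/
theorem grace_apolarity_discs (n : ℕ) (κ : Fin n →₀ ℕ) (Cs : Fin n → Set ℂ)
    (hC : ∀ i, (∃ w r, 0 < r ∧ Cs i = Metric.ball w r) ∨
      (∃ w r, 0 < r ∧ Cs i = (Metric.closedBall w r)ᶜ))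
    (f g : MvPolynomial (Fin n) ℂ)
    (hfdeg : ∀ i, f.degreeOf i ≤ κ i) (hgdeg : ∀ i, g.degreeOf i ≤ κ i)
    (hfs : ∀ z : Fin n → ℂ, (∀ i, z i ∈ Cs i) → eval z f ≠ 0)
    (hfd : ∀ j, (∃ w r, 0 < r ∧ Cs j = (Metric.closedBall w r)ᶜ) → f.degreeOf j = κ j)
    (hgs : ∀ z : Fin n → ℂ, (∀ i, z i ∈ (Cs i)ᶜ) → eval z g ≠ 0)
    (hgd : ∀ j, (∃ w r, 0 < r ∧ Cs j = Metric.ball w r) → g.degreeOf j = κ j) :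
    apolarForm κ f g ≠ 0 := by
  choose Q hQ hmem hap hinf hext hbal hw hne hnc using fun i => region (Cs i) (hC i)
  have hf0 : f ≠ 0 := by
    rintro rfl
    choose z hz using hne
    exact hfs z hz (by simp)
  have hg0 : g ≠ 0 := by
    rintro rfl
    choose z hz using hnc
    exact hgs z hz (by simp)
  have hF := ext_open κ f hfdeg hf0 Q hQ (fun z hz => hfs z fun i => (hmem i _).2 (hz i))
    (fun j hj => hfd j (hext j hj))
  have hG := ext_closed κ g hgdeg hg0 Q hQ (fun z hz => hgs z fun i => by
      rw [Set.mem_compl_iff, hmem, not_lt]; exact hz i)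
    (fun j hj => hgd j (hbal j hj)) hap hinf
  obtain ⟨ε, hε, hG'⟩ := slack κ (cf κ g) Q hQ hG
  rw [apolar_eq]
  refine keyn n κ Q (fun i p => -(Q i p + ε * (Complex.normSq p.1 + Complex.normSq p.2))) hQ
    (fun i => ((hQ i).add_norm ε).neg) ?_ (fun i => hw i ε hε) (fun α β => cf κ f α * cf κ g β) ?_
  · intro i q hq hq0
    have : 0 < Complex.normSq q.1 + Complex.normSq q.2 := by
      have a1 := Complex.normSq_nonneg q.1
      have a2 := Complex.normSq_nonneg q.2
      by_cases h1 : q.1 = 0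
      · have h2 : q.2 ≠ 0 := fun h => hq (Prod.ext h1 h)
        have := Complex.normSq_pos.2 h2
        linarith
      · have := Complex.normSq_pos.2 h1
        linarith
    have := mul_pos hε this
    linarith
  · intro p q hp hq
    have := mul_ne_zero (hF p hp) (hG' q hq)
    convert this using 1
    unfold hform
    rw [Finset.sum_mul_sum]
    refine Finset.sum_congr rfl fun α _ => Finset.sum_congr rfl fun β _ => ?_
    ring
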